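/- arXiv:2308.00372 — 2 statements merged into one kernel-verified Lean document; each statement's English description precedes it below -/
import Mathlib

section
/- Assume ω ∈ ℝ^r is nonresonant (α·ω = 0 implies α = 0 for α ∈ ℤ^r). Let κ ≥ 0, q ∈ ℕ, M > 0, C_a > 0, c ∈ (0,1), c_q > 0. Let a : [0,∞) → End(X) be sharp-flat of class κ with 𝒩_κ(a) ≤ M, of class C^q with sup_{0≤p≤q} sup_{τ≥0} |∂_τ^p a_τ| ≤ C_a M. Let φ, φ̃ : [0,∞) → End(X) be sharp-flat of class κ and of class C^q with 𝒩_κ(φ − id) ≤ c, 𝒩_κ(φ̃ − id) ≤ c, sup_{0≤p≤q} sup_τ |∂_τ^p φ_τ| ≤ c_q and sup_{0≤p≤q} sup_τ |∂_τ^p φ̃_τ| ≤ c_q. Then, with Λ{φ}_τ := a_τφ_τ − φ_τ⟨aφ⟩, sup_{0≤p≤q} sup_{τ≥0} |∂_τ^p(Λ{φ}_τ − Λ{φ̃}_τ)| ≤ (2^q C_a + c_q + 1 + c) M · sup_{0≤p≤q} sup_{τ≥0} |∂_τ^p(φ_τ − φ̃_τ)|. -/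
open scoped BigOperators
open Filter MeasureTheory

noncomputable section

variable {X : Type*} [NormedAddCommGroup X] [NormedSpace ℂ X] [CompleteSpace X]

/-- `|α| = |α₁| + ⋯ + |α_r|` for a multi-index `α ∈ ℤ^r`. -/
def absIdx {r : ℕ} (α : Fin r → ℤ) : ℝ := ∑ i, |(α i : ℝ)|

/-- `α · ω = α₁ω₁ + ⋯ + α_rω_r`. -/
def dotIdx {r : ℕ} (ω : Fin r → ℝ) (α : Fin r → ℤ) : ℝ := ∑ i, (α i : ℝ) * ω i

/-- The quasi-periodic ("sharp") map generated by a family of Fourier coefficients: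
`τ ↦ Σ_α e^{i(α·ω)τ} φ̂_α`. -/
def sharpSum {r : ℕ} (ω : Fin r → ℝ) (φhat : (Fin r → ℤ) → (X →L[ℂ] X)) (τ : ℝ) :
    X →L[ℂ] X :=
  ∑' α : Fin r → ℤ, Complex.exp (Complex.I * (dotIdx ω α : ℂ) * (τ : ℂ)) • φhat α

/-- The weighted ℓ¹-norm `Σ_α e^{κ|α|} ‖φ̂_α‖` of a family of Fourier coefficients. -/
def sharpNorm {r : ℕ} (κ : ℝ) (φhat : (Fin r → ℤ) → (X →L[ℂ] X)) : ℝ :=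
  ∑' α : Fin r → ℤ, Real.exp (κ * absIdx α) * ‖φhat α‖

/-- `sup_{τ ≥ 0} e^τ ‖φ♭_τ‖` for the exponentially decaying ("flat") part. -/
def flatSup (φflat : ℝ → (X →L[ℂ] X)) : ℝ :=
  ⨆ τ : Set.Ici (0:ℝ), Real.exp (τ : ℝ) * ‖φflat (τ : ℝ)‖

/-- The sharp-flat norm `𝒩_κ(φ) = Σ_α e^{κ|α|}‖φ̂_α‖ + sup_{τ≥0} e^τ‖φ♭_τ‖`. -/
def SFNorm {r : ℕ} (κ : ℝ) (φhat : (Fin r → ℤ) → (X →L[ℂ] X))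
    (φflat : ℝ → (X →L[ℂ] X)) : ℝ :=
  sharpNorm κ φhat + flatSup φflat

/-- `φ : [0,∞) → End(X)` is sharp-flat of class `κ`, with sharp Fourier coefficients
`φhat` and flat part `φflat`. -/
structure IsSharpFlat {r : ℕ} (ω : Fin r → ℝ) (κ : ℝ) (φ : ℝ → (X →L[ℂ] X))
    (φhat : (Fin r → ℤ) → (X →L[ℂ] X)) (φflat : ℝ → (X →L[ℂ] X)) : Prop where
  summable : Summable fun α : Fin r → ℤ => Real.exp (κ * absIdx α) * ‖φhat α‖
  flat_cont : ContinuousOn φflat (Set.Ici 0)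
  flat_bdd : BddAbove (Set.range fun τ : Set.Ici (0:ℝ) => Real.exp (τ : ℝ) * ‖φflat (τ : ℝ)‖)
  decomp : ∀ τ : ℝ, 0 ≤ τ → φ τ = sharpSum ω φhat τ + φflat τ

/-- The time average `⟨φ⟩ = lim_{T→∞} (1/T) ∫₀^T φ_σ dσ` equals `B`. -/
def HasTimeAvg {E : Type*} [NormedAddCommGroup E] [NormedSpace ℝ E] (φ : ℝ → E) (B : E) : Prop :=
  Tendsto (fun T : ℝ => (1 / T) • ∫ σ in (0:ℝ)..T, φ σ) atTop (nhds B)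

/-- The constant `c_I(κ) = max{1, (1/c_D)(ν/(κe))^ν}` from the integration lemma. -/
def cI (c_D ν κ : ℝ) : ℝ := max 1 ((1 / c_D) * (ν / (κ * Real.exp 1)) ^ ν)

theorem LDL_core {A : Type*} [NormedRing A] [NormedAlgebra ℝ A]
    (q : ℕ) (M C_a c c_q D : ℝ) (hM : 0 < M) (hCa : 0 < C_a) (hcq : 0 < c_q)
    (hc0 : 0 < c) (a φ φt : ℝ → A) (B Bt : A)
    (haq : ContDiffOn ℝ (q : ℕ∞) a (Set.Ici 0))
    (habd : ∀ p ≤ q, ∀ τ : ℝ, 0 ≤ τ →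
      ‖iteratedDerivWithin p a (Set.Ici 0) τ‖ ≤ C_a * M)
    (hφq : ContDiffOn ℝ (q : ℕ∞) φ (Set.Ici 0))
    (hφtq : ContDiffOn ℝ (q : ℕ∞) φt (Set.Ici 0))
    (hφtd : ∀ p ≤ q, ∀ τ : ℝ, 0 ≤ τ → ‖iteratedDerivWithin p φt (Set.Ici 0) τ‖ ≤ c_q)
    (hD : ∀ p ≤ q, ∀ τ : ℝ, 0 ≤ τ →
      ‖iteratedDerivWithin p (fun τ => φ τ - φt τ) (Set.Ici 0) τ‖ ≤ D)
    (ha0 : ∀ τ : ℝ, 0 ≤ τ → ‖a τ‖ ≤ M)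
    (hφ0 : ∀ τ : ℝ, 0 ≤ τ → ‖φ τ‖ ≤ 1 + c)
    (hB : HasTimeAvg (fun τ => a τ * φ τ) B)
    (hBt : HasTimeAvg (fun τ => a τ * φt τ) Bt) :
    ∀ p ≤ q, ∀ τ : ℝ, 0 ≤ τ →
      ‖iteratedDerivWithin p
          (fun τ => (a τ * φ τ - φ τ * B) - (a τ * φt τ - φt τ * Bt))
          (Set.Ici 0) τ‖ ≤
        (2 ^ q * C_a + c_q + 1 + c) * M * D := by
  have hD0 : 0 ≤ D := le_trans (norm_nonneg _) (hD 0 (Nat.zero_le _) 0 le_rfl)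
  have hD' : ∀ τ : ℝ, 0 ≤ τ → ‖φ τ - φt τ‖ ≤ D := fun τ hτ => by
    simpa using hD 0 (Nat.zero_le _) τ hτ
  -- bound on time averages
  have avg : ∀ (f : ℝ → A) (L : A) (K : ℝ), (∀ τ, 0 ≤ τ → ‖f τ‖ ≤ K) → HasTimeAvg f L →
      ‖L‖ ≤ K := by
    intro f L K hf hL
    refine le_of_tendsto hL.norm ?_
    filter_upwards [eventually_gt_atTop 0] with T hT
    have h1 : ‖∫ σ in (0:ℝ)..T, f σ‖ ≤ K * |T - 0| := by
      apply intervalIntegral.norm_integral_le_of_norm_le_const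
      intro x hx
      rw [Set.uIoc_of_le hT.le] at hx
      exact hf x hx.1.le
    rw [sub_zero, abs_of_pos hT] at h1
    rw [norm_smul, Real.norm_of_nonneg (by positivity)]
    calc 1 / T * ‖∫ σ in (0:ℝ)..T, f σ‖ ≤ 1 / T * (K * T) := by gcongr
      _ = K := by field_simp
  have hBn : ‖B‖ ≤ M * (1 + c) := by
    refine avg _ _ _ (fun τ hτ => ?_) hB
    refine (norm_mul_le _ _).trans ?_
    exact mul_le_mul (ha0 τ hτ) (hφ0 τ hτ) (norm_nonneg _) hM.le
  have hdiff : HasTimeAvg (fun τ => a τ * (φ τ - φt τ)) (B - Bt) := by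
    refine (hB.sub hBt).congr' ?_
    filter_upwards [eventually_gt_atTop 0] with T hT
    have hint : ∀ ψ : ℝ → A, ContinuousOn ψ (Set.Ici 0) →
        IntervalIntegrable (fun τ => a τ * ψ τ) volume 0 T := by
      intro ψ hψ
      apply ContinuousOn.intervalIntegrable
      rw [Set.uIcc_of_le hT.le]
      exact (haq.continuousOn.mul hψ).mono Set.Icc_subset_Ici_self
    rw [← smul_sub, ← intervalIntegral.integral_sub (hint _ hφq.continuousOn)
      (hint _ hφtq.continuousOn)]
    simp only [mul_sub]
  have hdn : ‖B - Bt‖ ≤ M * D := by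
    refine avg _ _ _ (fun τ hτ => ?_) hdiff
    refine (norm_mul_le _ _).trans ?_
    exact mul_le_mul (ha0 τ hτ) (hD' τ hτ) (norm_nonneg _) hM.le
  intro p hp τ hτ
  have hτ' : τ ∈ Set.Ici (0:ℝ) := hτ
  have hu : UniqueDiffOn ℝ (Set.Ici (0:ℝ)) := uniqueDiffOn_Ici 0
  have hpq : ((p : ℕ) : WithTop ℕ∞) ≤ ((q : ℕ∞) : WithTop ℕ∞) := by exact_mod_cast hp
  have hψq : ContDiffOn ℝ (q : ℕ∞) (fun τ => φ τ - φt τ) (Set.Ici 0) := hφq.sub hφtq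
  have rmul : ∀ (ψ : ℝ → A) (C : A) (K : ℝ), ContDiffOn ℝ (q : ℕ∞) ψ (Set.Ici 0) →
      ‖iteratedDerivWithin p ψ (Set.Ici 0) τ‖ ≤ K →
      ‖iteratedDerivWithin p (fun τ => ψ τ * C) (Set.Ici 0) τ‖ ≤ K * ‖C‖ := by
    intro ψ C K hψ hK
    have h := ((ContinuousLinearMap.mul ℝ A).flip C).norm_iteratedFDerivWithin_comp_left
      (hψ.contDiffWithinAt hτ') hu hτ' hpq
    rw [norm_iteratedFDerivWithin_eq_norm_iteratedDerivWithin,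
      norm_iteratedFDerivWithin_eq_norm_iteratedDerivWithin] at h
    have hn : ‖(ContinuousLinearMap.mul ℝ A).flip C‖ ≤ ‖C‖ := by
      refine ContinuousLinearMap.opNorm_le_bound _ (norm_nonneg _) fun x => ?_
      simpa [mul_comm] using norm_mul_le x C
    refine le_trans h ?_
    rw [mul_comm K]
    exact mul_le_mul hn hK (norm_nonneg _) (norm_nonneg _)
  have h1 : ‖iteratedDerivWithin p (fun τ => a τ * (φ τ - φt τ)) (Set.Ici 0) τ‖ ≤
      2 ^ q * (C_a * M * D) := by
    have h := norm_iteratedFDerivWithin_mul_le haq hψq hu hτ' hpq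
    simp only [norm_iteratedFDerivWithin_eq_norm_iteratedDerivWithin] at h
    refine h.trans ?_
    calc _ ≤ ∑ i ∈ Finset.range (p + 1), (p.choose i : ℝ) * (C_a * M * D) := by
          refine Finset.sum_le_sum fun i hi => ?_
          rw [mul_assoc]
          refine mul_le_mul_of_nonneg_left ?_ (Nat.cast_nonneg _)
          have hi' : i ≤ p := Nat.lt_succ_iff.1 (Finset.mem_range.1 hi)
          exact mul_le_mul (habd i (hi'.trans hp) τ hτ)
            (hD (p - i) ((Nat.sub_le _ _).trans hp) τ hτ) (norm_nonneg _) (by positivity)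
      _ = 2 ^ p * (C_a * M * D) := by
          rw [← Finset.sum_mul, ← Nat.cast_sum, Nat.sum_range_choose]
          push_cast
          rfl
      _ ≤ 2 ^ q * (C_a * M * D) := by
          gcongr
          norm_num
  have h2 := rmul _ B D hψq (hD p hp τ hτ)
  have h3 := rmul _ (B - Bt) c_q hφtq (hφtd p hp τ hτ)
  have e : (fun τ => (a τ * φ τ - φ τ * B) - (a τ * φt τ - φt τ * Bt)) =
      ((fun τ => a τ * (φ τ - φt τ)) - (fun τ => (φ τ - φt τ) * B)) -
        (fun τ => φt τ * (B - Bt)) := by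
    funext t
    simp only [Pi.sub_apply]
    noncomm_ring
  have c1 := ((haq.mul hψq).contDiffWithinAt hτ').of_le hpq
  have c2 := ((hψq.mul (contDiffOn_const (c := B))).contDiffWithinAt hτ').of_le hpq
  have c3 := ((hφtq.mul (contDiffOn_const (c := B - Bt))).contDiffWithinAt hτ').of_le hpq
  have c12 : ContDiffWithinAt ℝ p ((fun τ => a τ * (φ τ - φt τ)) - (fun τ => (φ τ - φt τ) * B))
      (Set.Ici 0) τ := c1.sub c2
  rw [e, iteratedDerivWithin_sub hτ' hu c12 c3, iteratedDerivWithin_sub hτ' hu c1 c2]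
  refine (norm_sub_le _ _).trans ?_
  have h4 := norm_sub_le (iteratedDerivWithin p (fun τ => a τ * (φ τ - φt τ)) (Set.Ici 0) τ)
    (iteratedDerivWithin p (fun τ => (φ τ - φt τ) * B) (Set.Ici 0) τ)
  have h5 : D * ‖B‖ ≤ D * (M * (1 + c)) := by gcongr
  have h6 : c_q * ‖B - Bt‖ ≤ c_q * (M * D) := by gcongr
  calc _ ≤ 2 ^ q * (C_a * M * D) + D * (M * (1 + c)) + c_q * (M * D) := by
        refine add_le_add (h4.trans (add_le_add h1 (h2.trans h5))) (h3.trans h6)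
    _ = _ := by ring

theorem LDL_absIdx_nonneg {r : ℕ} (α : Fin r → ℤ) : 0 ≤ absIdx α :=
  Finset.sum_nonneg fun _ _ => abs_nonneg _

/-- A sharp-flat map is bounded by a bound for the weights plus the flat norm. -/
theorem LDL_sup {r : ℕ} {ω : Fin r → ℝ} {κ : ℝ} (hκ : 0 ≤ κ) {φ : ℝ → (X →L[ℂ] X)}
    {φhat : (Fin r → ℤ) → (X →L[ℂ] X)} {φflat : ℝ → (X →L[ℂ] X)}
    (h : IsSharpFlat ω κ φ φhat φflat) (τ : ℝ) (hτ : 0 ≤ τ) :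
    ‖φ τ‖ ≤ SFNorm κ φhat φflat := by
  rw [h.decomp τ hτ]
  refine (norm_add_le _ _).trans (add_le_add ?_ ?_)
  · unfold sharpSum sharpNorm
    refine tsum_of_norm_bounded h.summable.hasSum fun α => ?_
    have e : Complex.I * (dotIdx ω α : ℂ) * (τ : ℂ) = ((dotIdx ω α * τ : ℝ) : ℂ) * Complex.I := by
      push_cast
      ring
    rw [norm_smul, e, Complex.norm_exp_ofReal_mul_I]
    refine mul_le_mul_of_nonneg_right ?_ (norm_nonneg _)
    exact Real.one_le_exp (mul_nonneg hκ (LDL_absIdx_nonneg α))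
  · have h1 := le_ciSup h.flat_bdd (⟨τ, hτ⟩ : Set.Ici (0:ℝ))
    refine le_trans ?_ h1
    exact le_mul_of_one_le_left (norm_nonneg _) (Real.one_le_exp hτ)

theorem LDL_shift {r : ℕ} {ω : Fin r → ℝ} {κ : ℝ} {φ : ℝ → (X →L[ℂ] X)}
    {φhat : (Fin r → ℤ) → (X →L[ℂ] X)} {φflat : ℝ → (X →L[ℂ] X)}
    (h : IsSharpFlat ω κ φ φhat φflat) :
    SFNorm κ φhat φflat ≤
      1 + SFNorm κ (fun α => if α = 0 then φhat 0 - 1 else φhat α) φflat := by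
  unfold SFNorm
  rw [← add_assoc]
  refine add_le_add ?_ le_rfl
  have h1 : ‖(1 : X →L[ℂ] X)‖ ≤ 1 := ContinuousLinearMap.norm_id_le
  have hs1 : HasSum (fun α : Fin r → ℤ => if α = 0 then (1:ℝ) else 0) 1 := hasSum_ite_eq 0 1
  have key : ∀ x y : X →L[ℂ] X, ‖x‖ ≤ ‖y‖ + ‖x - y‖ := fun x y => norm_le_norm_add_norm_sub' x y
  have hs2 : Summable fun α : Fin r → ℤ => Real.exp (κ * absIdx α) *
      ‖if α = 0 then φhat 0 - 1 else φhat α‖ := by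
    refine Summable.of_nonneg_of_le (fun α => by positivity) (fun α => ?_)
      (h.summable.add hs1.summable)
    by_cases hα : α = 0
    · subst hα
      have : absIdx (0 : Fin r → ℤ) = 0 := by simp [absIdx]
      simp only [this, mul_zero, Real.exp_zero, one_mul, if_true]
      exact (norm_sub_le _ _).trans (add_le_add le_rfl h1)
    · simp [hα]
  unfold sharpNorm
  refine hasSum_le (fun α => ?_) h.summable.hasSum (hs1.add hs2.hasSum)
  by_cases hα : α = 0
  · subst hα
    have : absIdx (0 : Fin r → ℤ) = 0 := by simp [absIdx]
    simp only [this, mul_zero, Real.exp_zero, one_mul, if_true]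
    have := key (φhat 0) 1
    linarith
  · simp [hα]

/-- Lipschitz bounds on the derivatives of `Λ`. Under the
assumptions of Statement 14, if moreover `φ, φ̃` satisfy
`sup_{p≤q}‖∂^p φ‖ ≤ c_q` and `sup_{p≤q}‖∂^p φ̃‖ ≤ c_q`, then
`sup_{p≤q}‖∂^p(Λ{φ} − Λ{φ̃})‖ ≤ (2^q C_a + c_q + 1 + c) M sup_{p≤q}‖∂^p(φ − φ̃)‖`. -/
theorem Lambda_deriv_lipschitz
    {r : ℕ} (ω : Fin r → ℝ)
    (hres : ∀ α : Fin r → ℤ, dotIdx ω α = 0 → α = 0)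
    {κ : ℝ} (hκ : 0 ≤ κ) (q : ℕ) (M C_a c c_q : ℝ)
    (hM : 0 < M) (hCa : 0 < C_a) (hc0 : 0 < c) (hc1 : c < 1) (hcq : 0 < c_q)
    (a : ℝ → (X →L[ℂ] X))
    (ahat : (Fin r → ℤ) → (X →L[ℂ] X)) (aflat : ℝ → (X →L[ℂ] X))
    (ha : IsSharpFlat ω κ a ahat aflat) (haM : SFNorm κ ahat aflat ≤ M)
    (haq : ContDiffOn ℝ (q : ℕ∞) a (Set.Ici 0))
    (habd : ∀ p ≤ q, ∀ τ : ℝ, 0 ≤ τ →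
      ‖iteratedDerivWithin p a (Set.Ici 0) τ‖ ≤ C_a * M)
    (φ φt : ℝ → (X →L[ℂ] X))
    (φhat φthat : (Fin r → ℤ) → (X →L[ℂ] X)) (φflat φtflat : ℝ → (X →L[ℂ] X))
    (hφ : IsSharpFlat ω κ φ φhat φflat) (hφt : IsSharpFlat ω κ φt φthat φtflat)
    (hφq : ContDiffOn ℝ (q : ℕ∞) φ (Set.Ici 0))
    (hφtq : ContDiffOn ℝ (q : ℕ∞) φt (Set.Ici 0))
    (hφc : SFNorm κ (fun α => if α = 0 then φhat 0 - 1 else φhat α) φflat ≤ c)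
    (hφtc : SFNorm κ (fun α => if α = 0 then φthat 0 - 1 else φthat α) φtflat ≤ c)
    (hφd : ∀ p ≤ q, ∀ τ : ℝ, 0 ≤ τ → ‖iteratedDerivWithin p φ (Set.Ici 0) τ‖ ≤ c_q)
    (hφtd : ∀ p ≤ q, ∀ τ : ℝ, 0 ≤ τ → ‖iteratedDerivWithin p φt (Set.Ici 0) τ‖ ≤ c_q)
    (B Bt : X →L[ℂ] X)
    (hB : HasTimeAvg (fun τ => a τ ∘L φ τ) B)
    (hBt : HasTimeAvg (fun τ => a τ ∘L φt τ) Bt)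
    (D : ℝ)
    (hD : ∀ p ≤ q, ∀ τ : ℝ, 0 ≤ τ →
      ‖iteratedDerivWithin p (fun τ => φ τ - φt τ) (Set.Ici 0) τ‖ ≤ D) :
    ∀ p ≤ q, ∀ τ : ℝ, 0 ≤ τ →
      ‖iteratedDerivWithin p
          (fun τ => (a τ ∘L φ τ - φ τ ∘L B) - (a τ ∘L φt τ - φt τ ∘L Bt))
          (Set.Ici 0) τ‖ ≤
        (2 ^ q * C_a + c_q + 1 + c) * M * D := by
  letI : NormedAlgebra ℝ (X →L[ℂ] X) := NormedAlgebra.complexToReal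
  exact LDL_core q M C_a c c_q D hM hCa hcq hc0 a φ φt B Bt haq habd hφq hφtq hφtd hD
    (fun τ hτ => (LDL_sup hκ ha τ hτ).trans haM)
    (fun τ hτ => ((LDL_sup hκ hφ τ hτ).trans (LDL_shift hφ)).trans (by linarith))
    hB hBt
end
end

section
/- (Bounds on the derivatives of the defect.) Assume ω ∈ ℝ^r satisfies the Diophantine condition with constants c_D > 0 and ν > 0. Let μ > 0, M > 0, c ∈ (0,1), q ∈ ℕ, C_a > 0, and let a : [0,∞) → End(X) be sharp-flat of class μ with 𝒩_μ(a) ≤ M, of class C^q with sup_{0≤p≤q} sup_{τ≥0} |∂_τ^p a_τ| ≤ C_a M. Then for every n ∈ ℕ there exist ε_n > 0 and C_δ > 0 (depending on n, q, c, C_a and the other data but not on ε) such that for every ε ∈ (0, ε_n] there exist a C^{q+1} map Φ : [0,∞) → End(X) and A ∈ End(X) satisfying ⟨Φ⟩ = id, A = ⟨aΦ⟩, sup_τ |Φ_τ − id| ≤ cε/ε_n, |A| ≤ (1+c)M, such that the defect δ_τ := ε^{-1}∂_τΦ_τ − (a_τΦ_τ − Φ_τA) satisfies sup_{τ≥0}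 |ε∫_0^τ δ_σ dσ| ≤ (ε/ε_n)^{n+1} and, in addition, sup_{0≤p≤q} sup_{τ≥0} |∂_τ^p δ_τ| ≤ C_δ M (ε/ε_n)^n. -/
open scoped BigOperators
open Filter MeasureTheory

noncomputable section

variable {X : Type*} [NormedAddCommGroup X] [NormedSpace ℂ X] [CompleteSpace X]

set_option linter.unusedSectionVars false

section Calculus

variable {E : Type*} [NormedRing E] [NormedAlgebra ℂ E] [CompleteSpace E]
variable {P : Type*} {r : ℕ}

/-- the character `e^{i(α·ω)τ}` -/
def chr (ω : Fin r → ℝ) (α : Fin r → ℤ) (τ : ℝ) : ℂ :=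
  Complex.exp (Complex.I * (dotIdx ω α : ℂ) * (τ : ℂ))

lemma norm_chr (ω : Fin r → ℝ) (α : Fin r → ℤ) (τ : ℝ) : ‖chr ω α τ‖ = 1 := by
  unfold chr
  have : Complex.I * (dotIdx ω α : ℂ) * (τ : ℂ) = ((dotIdx ω α * τ : ℝ) : ℂ) * Complex.I := by
    push_cast; ring
  rw [this, Complex.norm_exp_ofReal_mul_I]

lemma continuous_chr (ω : Fin r → ℝ) (α : Fin r → ℤ) : Continuous (chr ω α) := by
  unfold chr; fun_prop

lemma chr_zero (ω : Fin r → ℝ) (τ : ℝ) : chr ω 0 τ = 1 := by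
  simp [chr, dotIdx]

lemma chr_add (ω : Fin r → ℝ) (α β : Fin r → ℤ) (τ : ℝ) :
    chr ω (α + β) τ = chr ω α τ * chr ω β τ := by
  unfold chr
  rw [← Complex.exp_add]
  congr 1
  have : dotIdx ω (α + β) = dotIdx ω α + dotIdx ω β := by
    simp [dotIdx, add_mul, Finset.sum_add_distrib]
  rw [this]; push_cast; ring

lemma hasDerivAt_chr (ω : Fin r → ℝ) (α : Fin r → ℤ) (τ : ℝ) :
    HasDerivAt (chr ω α) ((Complex.I * (dotIdx ω α : ℂ)) * chr ω α τ) τ := by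
  unfold chr
  have h1 : HasDerivAt (fun τ : ℝ => (τ : ℂ)) 1 τ := Complex.ofRealCLM.hasDerivAt
  have h2 := (h1.const_mul (Complex.I * (dotIdx ω α : ℂ))).cexp
  convert h2 using 1
  ring

lemma absIdx_nonneg (α : Fin r → ℤ) : 0 ≤ absIdx α :=
  Finset.sum_nonneg fun _ _ => abs_nonneg _

lemma absIdx_add (α β : Fin r → ℤ) : absIdx (α + β) ≤ absIdx α + absIdx β := by
  unfold absIdx
  rw [← Finset.sum_add_distrib]
  refine Finset.sum_le_sum fun i _ => ?_
  simpa using abs_add_le (α i : ℝ) (β i : ℝ)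

lemma absIdx_pos (α : Fin r → ℤ) (h : α ≠ 0) : 0 < absIdx α := by
  obtain ⟨i, hi⟩ := Function.ne_iff.1 h
  refine Finset.sum_pos' (fun _ _ => abs_nonneg _) ⟨i, Finset.mem_univ _, ?_⟩
  simpa using hi

/-- Uniform families of quasi-periodic maps with frequencies in `S`. -/
def Sharp (ω : Fin r → ℝ) (S : Set (Fin r → ℤ)) (κ : ℝ) (s : P → ℝ → E) : Prop :=
  ∃ (J : Type) (α : J → Fin r → ℤ) (F : P → J → E) (u : J → ℝ),
    (∀ i, α i ∈ S) ∧ (∀ i, 0 ≤ u i) ∧ (Summable fun i => Real.exp (κ * absIdx (α i)) * u i) ∧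
    (∀ ε i, ‖F ε i‖ ≤ u i) ∧ ∀ ε τ, HasSum (fun i => chr ω (α i) τ • F ε i) (s ε τ)

/-- Uniform families of exponentially decaying maps. -/
def Flat (f : P → ℝ → E) : Prop :=
  (∀ ε, ContinuousOn (f ε) (Set.Ici 0)) ∧
    ∃ C : ℝ, 0 ≤ C ∧ ∀ ε, ∀ τ : ℝ, 0 ≤ τ → ‖f ε τ‖ ≤ C * Real.exp (-τ)

/-- Uniform families of sharp-flat maps. -/
def SF (ω : Fin r → ℝ) (S : Set (Fin r → ℤ)) (f : P → ℝ → E) : Prop :=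
  ∃ κ : ℝ, 0 < κ ∧ ∃ s : P → ℝ → E, Sharp ω S κ s ∧ Flat (fun ε τ => f ε τ - s ε τ)

variable {ω : Fin r → ℝ} {S : Set (Fin r → ℤ)} {κ κ' : ℝ} {s t f g : P → ℝ → E}

lemma summable_u {J : Type} {α : J → Fin r → ℤ} {u : J → ℝ} (hκ : 0 ≤ κ) (h0 : ∀ i, 0 ≤ u i)
    (h : Summable fun i => Real.exp (κ * absIdx (α i)) * u i) : Summable u := by
  refine Summable.of_nonneg_of_le h0 (fun i => ?_) h
  have : 1 ≤ Real.exp (κ * absIdx (α i)) :=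
    Real.one_le_exp (mul_nonneg hκ (absIdx_nonneg _))
  nlinarith [h0 i]

lemma Sharp.mono (h : Sharp ω S κ s) (hk : κ' ≤ κ) : Sharp ω S κ' s := by
  obtain ⟨J, α, F, u, hS, h0, hs, hF, hsum⟩ := h
  refine ⟨J, α, F, u, hS, h0, ?_, hF, hsum⟩
  refine Summable.of_nonneg_of_le (fun i => mul_nonneg (Real.exp_nonneg _) (h0 i)) (fun i => ?_) hs
  have := absIdx_nonneg (α i)
  have := h0 i
  gcongr

lemma Sharp.mono_set {S' : Set (Fin r → ℤ)} (h : Sharp ω S κ s) (hk : S ⊆ S') :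
    Sharp ω S' κ s := by
  obtain ⟨J, α, F, u, hS, h⟩ := h
  exact ⟨J, α, F, u, fun i => hk (hS i), h⟩

lemma Sharp.bdd (h : Sharp ω S κ s) (hκ : 0 ≤ κ) : ∃ K : ℝ, 0 ≤ K ∧ ∀ ε τ, ‖s ε τ‖ ≤ K := by
  obtain ⟨J, α, F, u, hS, h0, hs, hF, hsum⟩ := h
  have hu := summable_u hκ h0 hs
  refine ⟨∑' i, u i, tsum_nonneg h0, fun ε τ => ?_⟩
  rw [← (hsum ε τ).tsum_eq]
  refine tsum_of_norm_bounded hu.hasSum fun i => ?_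
  rw [norm_smul, norm_chr, one_mul]; exact hF ε i

lemma Sharp.cont (h : Sharp ω S κ s) (hκ : 0 ≤ κ) (ε : P) : Continuous (s ε) := by
  obtain ⟨J, α, F, u, hS, h0, hs, hF, hsum⟩ := h
  have hu := summable_u hκ h0 hs
  have : s ε = fun τ => ∑' i, chr ω (α i) τ • F ε i := by
    ext τ; rw [(hsum ε τ).tsum_eq]
  rw [this]
  refine continuous_tsum (fun i => (continuous_chr _ _).smul continuous_const) hu fun i τ => ?_
  rw [norm_smul, norm_chr, one_mul]; exact hF ε i

lemma Sharp.add (h : Sharp ω S κ s) (h' : Sharp ω S κ t) :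
    Sharp ω S κ (fun ε τ => s ε τ + t ε τ) := by
  obtain ⟨J, α, F, u, hS, h0, hs, hF, hsum⟩ := h
  obtain ⟨J', α', F', u', hS', h0', hs', hF', hsum'⟩ := h'
  refine ⟨J ⊕ J', Sum.elim α α', fun ε => Sum.elim (F ε) (F' ε), Sum.elim u u', ?_, ?_, ?_, ?_, ?_⟩
  · rintro (i | i) <;> simp [hS, hS']
  · rintro (i | i) <;> simp [h0, h0']
  · have := HasSum.sum (f := fun i => Real.exp (κ * absIdx (Sum.elim α α' i)) * Sum.elim u u' i)
      hs.hasSum hs'.hasSum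
    exact this.summable
  · intro ε i
    cases i with
    | inl i => exact hF ε i
    | inr i => exact hF' ε i
  · intro ε τ
    exact HasSum.sum
      (f := fun i => chr ω (Sum.elim α α' i) τ • (Sum.elim (F ε) (F' ε) i : E))
      (hsum ε τ) (hsum' ε τ)

lemma Sharp.mul_const (h : Sharp ω S κ s) {B : P → E} {K : ℝ} (hB : ∀ ε, ‖B ε‖ ≤ K)
    (hK : 0 ≤ K) : Sharp ω S κ (fun ε τ => s ε τ * B ε) := by
  obtain ⟨J, α, F, u, hS, h0, hs, hF, hsum⟩ := h
  refine ⟨J, α, fun ε i => F ε i * B ε, fun i => u i * K, hS, fun i => mul_nonneg (h0 i) hK,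
    ?_, fun ε i => ?_, fun ε τ => ?_⟩
  · simpa [mul_assoc] using hs.mul_right K
  · exact (norm_mul_le _ _).trans (mul_le_mul (hF ε i) (hB ε) (norm_nonneg _) (h0 i))
  · simpa using (hsum ε τ).mul_right (B ε)

lemma Sharp.const {B : P → E} {K : ℝ} (hB : ∀ ε, ‖B ε‖ ≤ K) (hK : 0 ≤ K) :
    Sharp ω Set.univ κ (fun ε (_ : ℝ) => B ε) := by
  refine ⟨Unit, fun _ => 0, fun ε _ => B ε, fun _ => K, fun _ => trivial, fun _ => hK,
    (hasSum_unique _).summable, fun ε _ => hB ε, fun ε τ => ?_⟩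
  simp only [chr_zero, one_smul]
  exact hasSum_unique (fun _ : Unit => B ε)

lemma Sharp.mul (h : Sharp ω Set.univ κ s) (h' : Sharp ω Set.univ κ t) (hκ : 0 ≤ κ) :
    Sharp ω Set.univ κ (fun ε τ => s ε τ * t ε τ) := by
  obtain ⟨J, α, F, u, hS, h0, hs, hF, hsum⟩ := h
  obtain ⟨J', α', F', u', hS', h0', hs', hF', hsum'⟩ := h'
  have hu := summable_u hκ h0 hs
  have hu' := summable_u hκ h0' hs'
  refine ⟨J × J', fun p => α p.1 + α' p.2, fun ε p => F ε p.1 * F' ε p.2,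
    fun p => u p.1 * u' p.2, fun _ => trivial, fun p => mul_nonneg (h0 _) (h0' _), ?_, ?_, ?_⟩
  · refine Summable.of_nonneg_of_le
      (fun p => mul_nonneg (Real.exp_nonneg _) (mul_nonneg (h0 _) (h0' _))) (fun p => ?_)
      (hs.mul_of_nonneg hs' (fun i => mul_nonneg (Real.exp_nonneg _) (h0 i))
        (fun i => mul_nonneg (Real.exp_nonneg _) (h0' i)))
    have e : Real.exp (κ * absIdx (α p.1 + α' p.2)) ≤
        Real.exp (κ * absIdx (α p.1)) * Real.exp (κ * absIdx (α' p.2)) := by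
      rw [← Real.exp_add, ← mul_add]
      have := absIdx_add (α p.1) (α' p.2)
      gcongr
    calc _ ≤ (Real.exp (κ * absIdx (α p.1)) * Real.exp (κ * absIdx (α' p.2))) *
          (u p.1 * u' p.2) := mul_le_mul_of_nonneg_right e (mul_nonneg (h0 _) (h0' _))
      _ = _ := by ring
  · intro ε p
    exact (norm_mul_le _ _).trans (mul_le_mul (hF ε _) (hF' ε _) (norm_nonneg _) (h0 _))
  · intro ε τ
    have n1 : Summable fun i => ‖chr ω (α i) τ • F ε i‖ :=
      Summable.of_nonneg_of_le (fun _ => norm_nonneg _)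
        (fun i => by rw [norm_smul, norm_chr, one_mul]; exact hF ε i) hu
    have n2 : Summable fun i => ‖chr ω (α' i) τ • F' ε i‖ :=
      Summable.of_nonneg_of_le (fun _ => norm_nonneg _)
        (fun i => by rw [norm_smul, norm_chr, one_mul]; exact hF' ε i) hu'
    have := (summable_mul_of_summable_norm n1 n2).hasSum
    rw [← tsum_mul_tsum_of_summable_norm n1 n2, (hsum ε τ).tsum_eq, (hsum' ε τ).tsum_eq] at this
    have e : (fun p : J × J' => chr ω (α p.1 + α' p.2) τ • (F ε p.1 * F' ε p.2)) =
        fun p : J × J' => (chr ω (α p.1) τ • F ε p.1) * (chr ω (α' p.2) τ • F' ε p.2) := by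
      funext p
      rw [chr_add, smul_mul_smul_comm]
    rw [e]
    exact this

lemma Sharp.split (h : Sharp ω Set.univ κ s) (hκ : 0 ≤ κ) :
    ∃ (m : P → E) (K : ℝ), 0 ≤ K ∧ (∀ ε, ‖m ε‖ ≤ K) ∧
      Sharp ω {0}ᶜ κ (fun ε τ => s ε τ - m ε) := by
  obtain ⟨J, α, F, u, hS, h0, hs, hF, hsum⟩ := h
  have hu := summable_u hκ h0 hs
  let Z : Set J := {i | α i = 0}
  refine ⟨fun ε => ∑' i : Z, F ε i, ∑' i : Z, u i, tsum_nonneg fun i => h0 i, fun ε => ?_, ?_⟩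
  · exact tsum_of_norm_bounded (hu.subtype Z).hasSum fun i => hF ε i
  · refine ⟨(Zᶜ : Set J), fun i => α i, fun ε i => F ε i, fun i => u i, fun i => i.2,
      fun i => h0 i, hs.subtype Zᶜ, fun ε i => hF ε i, fun ε τ => ?_⟩
    have hZ : HasSum ((fun i => chr ω (α i) τ • F ε i) ∘ ((↑) : Z → J)) (∑' i : Z, F ε i) := by
      have : ((fun i => chr ω (α i) τ • F ε i) ∘ ((↑) : Z → J)) = fun i : Z => F ε i := by
        ext i
        have : α i = 0 := i.2
        simp [this, chr_zero]
      rw [this]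
      exact (Summable.of_norm_bounded (f := fun i : Z => F ε i) (hu.subtype Z) fun i => hF ε i).hasSum
    have hC := ((hsum ε τ).summable.subtype Zᶜ).hasSum
    have := (hZ.add_compl hC).unique (hsum ε τ)
    have e := eq_sub_of_add_eq' this
    rw [e] at hC
    exact hC

lemma rpow_exp_bound {ν d : ℝ} (hν : 0 < ν) (hd : 0 < d) :
    ∃ C : ℝ, 0 ≤ C ∧ ∀ x : ℝ, 0 ≤ x → x ^ ν ≤ C * Real.exp (d * x) := by
  refine ⟨(ν / d) ^ ν, by positivity, fun x hx => ?_⟩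
  have h1 : x ≤ (ν / d) * Real.exp (d * x / ν) := by
    have := Real.add_one_le_exp (d * x / ν)
    have h2 : x = (ν / d) * (d * x / ν) := by field_simp
    calc x = (ν / d) * (d * x / ν) := h2
      _ ≤ _ := by gcongr; linarith
  calc x ^ ν ≤ ((ν / d) * Real.exp (d * x / ν)) ^ ν := Real.rpow_le_rpow hx h1 hν.le
    _ = _ := by
      rw [Real.mul_rpow (by positivity) (Real.exp_nonneg _), ← Real.exp_mul]
      congr 2; field_simp

set_option maxHeartbeats 1000000 in
lemma Sharp.int {c_D ν : ℝ} (hcD : 0 < c_D) (hν : 0 < ν)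
    (hdio : ∀ α : Fin r → ℤ, α ≠ 0 → c_D / (absIdx α) ^ ν ≤ |dotIdx ω α|)
    (h : Sharp ω {0}ᶜ κ s) (hκ' : 0 ≤ κ') (hk : κ' < κ) :
    ∃ t : P → ℝ → E, Sharp ω {0}ᶜ κ' t ∧ ∀ ε τ, HasDerivAt (t ε) (s ε τ) τ := by
  obtain ⟨J, α, F, u, hS, h0, hs, hF, hsum⟩ := h
  have hu := summable_u (hκ'.trans hk.le) h0 hs
  obtain ⟨C, hC0, hC⟩ := rpow_exp_bound hν (sub_pos.2 hk)
  have hne : ∀ i, α i ≠ 0 := hS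
  have hpos : ∀ i, 0 < c_D / (absIdx (α i)) ^ ν := fun i =>
    div_pos hcD (Real.rpow_pos_of_pos (absIdx_pos _ (hne i)) _)
  have hd : ∀ i, (Complex.I * (dotIdx ω (α i) : ℂ)) ≠ 0 := fun i => by
    have := (hpos i).trans_le (hdio _ (hne i))
    simpa using this
  let v : J → ℝ := fun i => (absIdx (α i)) ^ ν / c_D * u i
  let G : P → J → E := fun ε i => (Complex.I * (dotIdx ω (α i) : ℂ))⁻¹ • F ε i
  have hv0 : ∀ i, 0 ≤ v i := fun i =>
    mul_nonneg (div_nonneg (Real.rpow_nonneg (absIdx_nonneg _) _) hcD.le) (h0 i)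
  have hvs : Summable fun i => Real.exp (κ' * absIdx (α i)) * v i := by
    refine Summable.of_nonneg_of_le (fun i => mul_nonneg (Real.exp_nonneg _) (hv0 i))
      (fun i => ?_) (hs.mul_left (C / c_D))
    have e : Real.exp (κ * absIdx (α i)) =
        Real.exp (κ' * absIdx (α i)) * Real.exp ((κ - κ') * absIdx (α i)) := by
      rw [← Real.exp_add]; congr 1; ring
    have := hC _ (absIdx_nonneg (α i))
    have := h0 i
    calc Real.exp (κ' * absIdx (α i)) * v i
        ≤ Real.exp (κ' * absIdx (α i)) *
          ((C * Real.exp ((κ - κ') * absIdx (α i))) / c_D * u i) := by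
          simp only [v]; gcongr
      _ = _ := by rw [e]; ring
  have hG : ∀ ε i, ‖G ε i‖ ≤ v i := fun ε i => by
    simp only [G, v]
    rw [norm_smul, norm_inv, norm_mul, Complex.norm_I, one_mul, Complex.norm_real, Real.norm_eq_abs]
    have h1 : |dotIdx ω (α i)|⁻¹ ≤ (absIdx (α i)) ^ ν / c_D := by
      rw [← inv_div]
      exact inv_anti₀ (hpos i) (hdio _ (hne i))
    exact mul_le_mul h1 (hF ε i) (norm_nonneg _) ((inv_nonneg.2 (abs_nonneg _)).trans h1)
  have hv := summable_u hκ' hv0 hvs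
  have hGs : ∀ ε τ, Summable fun i => chr ω (α i) τ • G ε i := fun ε τ => by
    refine Summable.of_norm_bounded hv fun i => ?_
    rw [norm_smul, norm_chr, one_mul]; exact hG ε i
  refine ⟨fun ε τ => ∑' i, chr ω (α i) τ • G ε i,
    ⟨J, α, G, v, hS, hv0, hvs, hG, fun ε τ => (hGs ε τ).hasSum⟩, fun ε τ => ?_⟩
  rw [← (hsum ε τ).tsum_eq]
  refine hasDerivAt_tsum (g' := fun i τ => chr ω (α i) τ • F ε i) hu (fun i y => ?_)
    (fun i y => ?_) (hGs ε 0) τ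
  · convert (hasDerivAt_chr ω (α i) y).smul_const (G ε i) using 1
    simp only [G]
    rw [smul_smul]
    congr 1
    rw [mul_right_comm, mul_inv_cancel₀ (hd i), one_mul]
  · rw [norm_smul, norm_chr, one_mul]; exact hF ε i

lemma exp_neg_le_one {τ : ℝ} (h : 0 ≤ τ) : Real.exp (-τ) ≤ 1 := by
  rw [Real.exp_le_one_iff]; linarith

lemma Flat.add (hf : Flat f) (hg : Flat g) : Flat (fun ε τ => f ε τ + g ε τ) := by
  obtain ⟨c1, C1, h1, b1⟩ := hf
  obtain ⟨c2, C2, h2, b2⟩ := hg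
  refine ⟨fun ε => (c1 ε).add (c2 ε), C1 + C2, by positivity, fun ε τ hτ => ?_⟩
  rw [add_mul]
  exact (norm_add_le _ _).trans (add_le_add (b1 ε τ hτ) (b2 ε τ hτ))

lemma Flat.mul_bdd (hf : Flat f) (hg : ∀ ε, ContinuousOn (g ε) (Set.Ici 0)) {K : ℝ} (hK : 0 ≤ K)
    (hb : ∀ ε, ∀ τ : ℝ, 0 ≤ τ → ‖g ε τ‖ ≤ K) : Flat (fun ε τ => f ε τ * g ε τ) := by
  obtain ⟨c1, C1, h1, b1⟩ := hf
  refine ⟨fun ε => (c1 ε).mul (hg ε), C1 * K, by positivity, fun ε τ hτ => ?_⟩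
  calc _ ≤ _ := norm_mul_le _ _
    _ ≤ (C1 * Real.exp (-τ)) * K :=
      mul_le_mul (b1 ε τ hτ) (hb ε τ hτ) (norm_nonneg _) (by positivity)
    _ = _ := by ring

lemma Flat.bdd_mul (hf : Flat f) (hg : ∀ ε, ContinuousOn (g ε) (Set.Ici 0)) {K : ℝ} (hK : 0 ≤ K)
    (hb : ∀ ε, ∀ τ : ℝ, 0 ≤ τ → ‖g ε τ‖ ≤ K) : Flat (fun ε τ => g ε τ * f ε τ) := by
  obtain ⟨c1, C1, h1, b1⟩ := hf
  refine ⟨fun ε => (hg ε).mul (c1 ε), K * C1, by positivity, fun ε τ hτ => ?_⟩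
  calc _ ≤ _ := norm_mul_le _ _
    _ ≤ K * (C1 * Real.exp (-τ)) :=
      mul_le_mul (hb ε τ hτ) (b1 ε τ hτ) (norm_nonneg _) hK
    _ = _ := by ring

lemma Flat.int (hf : Flat f) :
    ∃ g : P → ℝ → E, Flat g ∧ ∀ ε, ∀ τ : ℝ, 0 ≤ τ → HasDerivAt (g ε)
      (f ε (max τ 0)) τ := by
  obtain ⟨c1, C, h1, b1⟩ := hf
  have hc : ∀ ε, Continuous fun τ : ℝ => f ε (max τ 0) := fun ε => by
    have := (c1 ε).comp_continuous (f := fun τ : ℝ => max τ 0) (by fun_prop)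
      (fun τ => Set.mem_Ici.2 (le_max_right _ _))
    exact this
  have hexp : ∀ a : ℝ, IntegrableOn (fun τ : ℝ => C * Real.exp (-τ)) (Set.Ioi a) := fun a =>
    (integrableOn_exp_neg_Ioi a).const_mul C
  have hb : ∀ ε, ∀ τ : ℝ, 0 ≤ τ → ‖f ε (max τ 0)‖ ≤ C * Real.exp (-τ) := fun ε τ hτ => by
    rw [max_eq_left hτ]; exact b1 ε τ hτ
  have hae : ∀ ε, ∀ a : ℝ, 0 ≤ a →
      ∀ᵐ τ ∂(volume.restrict (Set.Ioi a)), ‖f ε (max τ 0)‖ ≤ C * Real.exp (-τ) := fun ε a ha =>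
    (ae_restrict_iff' measurableSet_Ioi).2 (Eventually.of_forall fun τ hτ =>
      hb ε τ (ha.trans (le_of_lt hτ)))
  have hint : ∀ ε, IntegrableOn (fun τ : ℝ => f ε (max τ 0)) (Set.Ioi 0) := fun ε =>
    Integrable.mono' (hexp 0) (hc ε).aestronglyMeasurable (hae ε 0 le_rfl)
  have hder : ∀ ε τ, HasDerivAt (fun x : ℝ => (∫ y in (0:ℝ)..x, f ε (max y 0)) -
      ∫ y in Set.Ioi (0:ℝ), f ε (max y 0)) (f ε (max τ 0)) τ := fun ε τ =>
    ((hc ε).integral_hasStrictDerivAt 0 τ).hasDerivAt.sub_const _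
  refine ⟨fun ε x => (∫ y in (0:ℝ)..x, f ε (max y 0)) - ∫ y in Set.Ioi (0:ℝ), f ε (max y 0),
    ⟨fun ε τ _ => (hder ε τ).continuousAt.continuousWithinAt, C, h1, fun ε τ hτ => ?_⟩,
    fun ε τ _ => hder ε τ⟩
  beta_reduce
  rw [← intervalIntegral.integral_Ioi_sub_Ioi (hint ε) hτ, sub_sub_cancel_left, norm_neg,
    ← integral_exp_neg_Ioi τ, ← integral_const_mul]
  exact norm_integral_le_of_norm_le (hexp τ) (hae ε τ hτ)

lemma SF.cont (h : SF ω S f) (ε : P) : ContinuousOn (f ε) (Set.Ici 0) := by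
  obtain ⟨κ, hκ, s, hs, hc, -⟩ := h
  have := (hc ε).add (hs.cont hκ.le ε).continuousOn
  exact this.congr fun τ _ => by simp

lemma SF.bdd (h : SF ω S f) :
    ∃ K : ℝ, 0 ≤ K ∧ ∀ ε, ∀ τ : ℝ, 0 ≤ τ → ‖f ε τ‖ ≤ K := by
  obtain ⟨κ, hκ, s, hs, -, C, hC, hb⟩ := h
  obtain ⟨K, hK, hsb⟩ := hs.bdd hκ.le
  refine ⟨C + K, by positivity, fun ε τ hτ => ?_⟩
  have h1 : ‖f ε τ - s ε τ‖ ≤ C :=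
    (hb ε τ hτ).trans (mul_le_of_le_one_right hC (exp_neg_le_one hτ))
  calc ‖f ε τ‖ = ‖(f ε τ - s ε τ) + s ε τ‖ := by rw [sub_add_cancel]
    _ ≤ _ := norm_add_le _ _
    _ ≤ _ := add_le_add h1 (hsb ε τ)

lemma SF.univ (h : SF ω S f) : SF ω Set.univ f := by
  obtain ⟨κ, hκ, s, hs, hf⟩ := h
  exact ⟨κ, hκ, s, hs.mono_set (Set.subset_univ _), hf⟩

lemma SF.add (hf : SF ω S f) (hg : SF ω S g) : SF ω S (fun ε τ => f ε τ + g ε τ) := by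
  obtain ⟨κ, hκ, s, hs, hf⟩ := hf
  obtain ⟨κ', hκ', t, ht, hg⟩ := hg
  refine ⟨min κ κ', lt_min hκ hκ', _, (hs.mono (min_le_left _ _)).add (ht.mono (min_le_right _ _)),
    ?_⟩
  have e : (fun ε τ => f ε τ + g ε τ - (s ε τ + t ε τ)) =
      fun ε τ => (f ε τ - s ε τ) + (g ε τ - t ε τ) := by
    funext ε τ; abel
  rw [e]
  exact hf.add hg

lemma SF.mul (hf : SF ω Set.univ f) (hg : SF ω Set.univ g) :
    SF ω Set.univ (fun ε τ => f ε τ * g ε τ) := by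
  have hgc := hg.cont
  obtain ⟨K, hK, hgb⟩ := hg.bdd
  obtain ⟨κ, hκ, s, hs, hf⟩ := hf
  obtain ⟨κ', hκ', t, ht, hg⟩ := hg
  obtain ⟨K', hK', hsb⟩ := hs.bdd hκ.le
  refine ⟨min κ κ', lt_min hκ hκ', _, (hs.mono (min_le_left _ _)).mul (ht.mono (min_le_right _ _))
    (lt_min hκ hκ').le, ?_⟩
  have e : (fun ε τ => f ε τ * g ε τ - (s ε τ * t ε τ)) =
      fun ε τ => (f ε τ - s ε τ) * g ε τ + s ε τ * (g ε τ - t ε τ) := by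
    funext ε τ; noncomm_ring
  rw [e]
  exact (hf.mul_bdd hgc hK hgb).add
    (hg.bdd_mul (fun ε => (hs.cont hκ.le ε).continuousOn) hK' (fun ε τ _ => hsb ε τ))

lemma SF.mul_const (hf : SF ω S f) {B : P → E} {K : ℝ} (hK : 0 ≤ K) (hB : ∀ ε, ‖B ε‖ ≤ K) :
    SF ω S (fun ε τ => f ε τ * B ε) := by
  obtain ⟨κ, hκ, s, hs, hf⟩ := hf
  refine ⟨κ, hκ, _, hs.mul_const hB hK, ?_⟩
  have := hf.mul_bdd (g := fun ε _ => B ε) (fun ε => continuousOn_const) hK (fun ε τ _ => hB ε)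
  simpa only [sub_mul] using this

lemma SF.smul (hf : SF ω S f) {c : P → ℝ} {K : ℝ} (hK : 0 ≤ K) (hc : ∀ ε, |c ε| ≤ K) :
    SF ω S (fun ε τ => c ε • f ε τ) := by
  have := hf.mul_const (B := fun ε => c ε • (1 : E)) (K := K * ‖(1 : E)‖) (by positivity)
    (fun ε => by
      rw [norm_smul, Real.norm_eq_abs]
      exact mul_le_mul_of_nonneg_right (hc ε) (norm_nonneg _))
  simpa only [mul_smul_comm, mul_one] using this

lemma SF.neg (hf : SF ω S f) : SF ω S (fun ε τ => - f ε τ) := by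
  simpa using hf.smul (c := fun _ => -1) (K := 1) zero_le_one (by simp)

lemma SF.sub (hf : SF ω S f) (hg : SF ω S g) : SF ω S (fun ε τ => f ε τ - g ε τ) := by
  simpa only [sub_eq_add_neg] using hf.add hg.neg

lemma SF.const {B : P → E} {K : ℝ} (hK : 0 ≤ K) (hB : ∀ ε, ‖B ε‖ ≤ K) :
    SF ω Set.univ (fun ε (_ : ℝ) => B ε) := by
  refine ⟨1, one_pos, _, Sharp.const hB hK, fun ε => ?_, 0, le_rfl, fun ε τ _ => ?_⟩
  · simpa using continuousOn_const
  · simp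

lemma SF.zero : SF ω S (fun (_ : P) (_ : ℝ) => (0 : E)) := by
  refine ⟨1, one_pos, fun _ _ => 0, ⟨Empty, fun i => i.elim, fun _ i => i.elim, fun i => i.elim,
    fun i => i.elim, fun i => i.elim, (hasSum_empty).summable, fun _ i => i.elim,
    fun _ _ => hasSum_empty⟩, fun ε => ?_, 0, le_rfl, fun ε τ _ => ?_⟩
  · simpa using continuousOn_const
  · simp

lemma SF.split (hf : SF ω Set.univ f) :
    ∃ (m : P → E) (K : ℝ), 0 ≤ K ∧ (∀ ε, ‖m ε‖ ≤ K) ∧ SF ω {0}ᶜ (fun ε τ => f ε τ - m ε) := by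
  obtain ⟨κ, hκ, s, hs, hf⟩ := hf
  obtain ⟨m, K, hK, hm, h⟩ := hs.split hκ.le
  refine ⟨m, K, hK, hm, κ, hκ, _, h, ?_⟩
  simpa only [sub_sub_sub_cancel_right] using hf

/-- The Diophantine condition. -/
def Dio (ω : Fin r → ℝ) : Prop := ∃ c_D ν : ℝ, 0 < c_D ∧ 0 < ν ∧
  ∀ α : Fin r → ℤ, α ≠ 0 → c_D / (absIdx α) ^ ν ≤ |dotIdx ω α|

lemma SF.int (hω : Dio ω) (hf : SF ω {0}ᶜ f) :
    ∃ g : P → ℝ → E, SF ω {0}ᶜ g ∧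
      ∀ ε, ∀ τ : ℝ, 0 ≤ τ → HasDerivWithinAt (g ε) (f ε τ) (Set.Ici 0) τ := by
  obtain ⟨c_D, ν, hcD, hν, hdio⟩ := hω
  obtain ⟨κ, hκ, s, hs, hf⟩ := hf
  obtain ⟨t, ht, hts⟩ := hs.int hcD hν hdio (κ' := κ / 2) (by positivity) (by linarith)
  obtain ⟨g, hg, hgf⟩ := hf.int
  refine ⟨fun ε τ => g ε τ + t ε τ, ⟨κ / 2, by positivity, t, ht, ?_⟩, fun ε τ hτ => ?_⟩
  · simpa only [add_sub_cancel_right] using hg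
  · have := (hgf ε τ hτ).add (hts ε τ)
    rw [max_eq_left hτ, sub_add_cancel] at this
    exact this.hasDerivWithinAt

lemma ftc {g f : ℝ → E} (hf : ContinuousOn f (Set.Ici 0))
    (h : ∀ τ : ℝ, 0 ≤ τ → HasDerivWithinAt g (f τ) (Set.Ici 0) τ) {τ : ℝ} (hτ : 0 ≤ τ) :
    ∫ σ in (0:ℝ)..τ, f σ = g τ - g 0 := by
  have hsub : Set.uIcc 0 τ ⊆ Set.Ici 0 := by
    rw [Set.uIcc_of_le hτ]; exact Set.Icc_subset_Ici_self
  refine intervalIntegral.integral_eq_sub_of_hasDeriv_right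
    (fun x hx => (h x (hsub hx)).continuousWithinAt.mono hsub) (fun x hx => ?_)
    (hf.mono hsub).intervalIntegrable
  have hx0 : 0 ≤ x := by
    rw [min_eq_left hτ] at hx; exact hx.1.le
  exact (h x hx0).mono fun y hy => hx0.trans (le_of_lt hy)

lemma SF.avg (hω : Dio ω) (hf : SF ω {0}ᶜ f) (ε : P) : HasTimeAvg (f ε) 0 := by
  obtain ⟨g, hg, hgf⟩ := hf.int hω
  obtain ⟨K, hK, hb⟩ := hg.bdd
  unfold HasTimeAvg
  have h0 : Tendsto (fun T : ℝ => (1 / T) * (K + K)) atTop (nhds 0) := by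
    have := (tendsto_inv_atTop_zero (𝕜 := ℝ)).mul_const (K + K)
    simpa using this
  refine squeeze_zero_norm' ?_ h0
  filter_upwards [eventually_gt_atTop 0] with T hT
  rw [ftc (hf.cont ε) (hgf ε) hT.le, norm_smul, Real.norm_of_nonneg (by positivity)]
  gcongr
  exact (norm_sub_le _ _).trans (add_le_add (hb ε T hT.le) (hb ε 0 le_rfl))

lemma avg_of_sub {f : ℝ → E} {B : E} (hf : ContinuousOn f (Set.Ici 0))
    (h : HasTimeAvg (fun τ => f τ - B) 0) : HasTimeAvg f B := by
  unfold HasTimeAvg at *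
  have := h.add_const B
  rw [zero_add] at this
  refine this.congr' ?_
  filter_upwards [eventually_gt_atTop 0] with T hT
  have hsub : Set.uIcc 0 T ⊆ Set.Ici 0 := by
    rw [Set.uIcc_of_le hT.le]; exact Set.Icc_subset_Ici_self
  rw [intervalIntegral.integral_sub (hf.mono hsub).intervalIntegrable (by simp),
    intervalIntegral.integral_const, smul_sub, sub_zero, smul_smul, one_div, inv_mul_cancel₀ hT.ne',
    one_smul, sub_add_cancel]

lemma avg_norm_le {f : ℝ → E} {B : E} {K : ℝ} 
    (h : HasTimeAvg f B) (hb : ∀ τ : ℝ, 0 ≤ τ → ‖f τ‖ ≤ K) : ‖B‖ ≤ K := by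
  refine le_of_tendsto h.norm ?_
  filter_upwards [eventually_gt_atTop 0] with T hT
  have := intervalIntegral.norm_integral_le_of_norm_le_const (a := 0) (b := T) (f := f) (C := K)
    (fun x hx => hb x (by rw [Set.uIoc_of_le hT.le] at hx; exact hx.1.le))
  rw [norm_smul, Real.norm_of_nonneg (by positivity), one_div]
  rw [sub_zero, abs_of_pos hT] at this
  calc _ ≤ T⁻¹ * (K * T) := by gcongr
    _ = K := by field_simp

/-- Uniform `C^q` bounds. -/
def CB (q : ℕ) (f : P → ℝ → E) : Prop :=
  (∀ ε, ContDiffOn ℝ q (f ε) (Set.Ici 0)) ∧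
    ∃ K : ℝ, 0 ≤ K ∧ ∀ p ≤ q, ∀ ε, ∀ τ : ℝ, 0 ≤ τ →
      ‖iteratedDerivWithin p (f ε) (Set.Ici 0) τ‖ ≤ K

variable {q : ℕ}

lemma CB.of_le {q' : ℕ} (hf : CB q f) (h : q' ≤ q) : CB q' f := by
  obtain ⟨c, K, hK, hb⟩ := hf
  exact ⟨fun ε => (c ε).of_le (by exact_mod_cast h), K, hK, fun p hp => hb p (hp.trans h)⟩

lemma CB.add (hf : CB q f) (hg : CB q g) : CB q (fun ε τ => f ε τ + g ε τ) := by
  obtain ⟨c, K, hK, hb⟩ := hf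
  obtain ⟨c', K', hK', hb'⟩ := hg
  refine ⟨fun ε => (c ε).add (c' ε), K + K', by positivity, fun p hp ε τ hτ => ?_⟩
  have hpq : (p : WithTop ℕ∞) ≤ q := by exact_mod_cast hp
  have := iteratedDerivWithin_add (n := p) (x := τ) (s := Set.Ici (0:ℝ)) hτ (uniqueDiffOn_Ici 0)
    (((c ε).of_le hpq) τ hτ) (((c' ε).of_le hpq) τ hτ)
  change ‖iteratedDerivWithin p (f ε + g ε) _ _‖ ≤ _
  rw [this]
  exact (norm_add_le _ _).trans (add_le_add (hb p hp ε τ hτ) (hb' p hp ε τ hτ))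

lemma CB.mul (hf : CB q f) (hg : CB q g) : CB q (fun ε τ => f ε τ * g ε τ) := by
  obtain ⟨c, K, hK, hb⟩ := hf
  obtain ⟨c', K', hK', hb'⟩ := hg
  refine ⟨fun ε => (c ε).mul (c' ε), 2 ^ q * (K * K'), by positivity, fun p hp ε τ hτ => ?_⟩
  have hpq : (p : WithTop ℕ∞) ≤ q := by exact_mod_cast hp
  rw [← norm_iteratedFDerivWithin_eq_norm_iteratedDerivWithin]
  refine (norm_iteratedFDerivWithin_mul_le (c ε) (c' ε) (uniqueDiffOn_Ici 0) hτ hpq).trans ?_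
  calc _ ≤ ∑ i ∈ Finset.range (p + 1), (p.choose i : ℝ) * (K * K') := by
        refine Finset.sum_le_sum fun i hi => ?_
        have hi' : i ≤ p := Nat.lt_succ_iff.1 (Finset.mem_range.1 hi)
        rw [norm_iteratedFDerivWithin_eq_norm_iteratedDerivWithin,
          norm_iteratedFDerivWithin_eq_norm_iteratedDerivWithin, mul_assoc]
        have h1 := hb i (hi'.trans hp) ε τ hτ
        have h2 := hb' (p - i) ((Nat.sub_le _ _).trans hp) ε τ hτ
        gcongr
    _ = 2 ^ p * (K * K') := by
        rw [← Finset.sum_mul]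
        congr 1
        exact_mod_cast Nat.sum_range_choose p
    _ ≤ _ := by
        gcongr
        norm_num

lemma CB.const {B : P → E} {K : ℝ} (hK : 0 ≤ K) (hB : ∀ ε, ‖B ε‖ ≤ K) :
    CB q (fun ε (_ : ℝ) => B ε) := by
  refine ⟨fun ε => contDiffOn_const, K, hK, fun p hp ε τ hτ => ?_⟩
  rw [iteratedDerivWithin_const]
  split_ifs
  · exact hB ε
  · simpa using hK

lemma CB.smul (hf : CB q f) {c : P → ℝ} {K : ℝ} (hK : 0 ≤ K) (hc : ∀ ε, |c ε| ≤ K) :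
    CB q (fun ε τ => c ε • f ε τ) := by
  have := hf.mul (CB.const (B := fun ε => c ε • (1 : E)) (K := K * ‖(1 : E)‖) (by positivity)
    (fun ε => by
      rw [norm_smul, Real.norm_eq_abs]
      exact mul_le_mul_of_nonneg_right (hc ε) (norm_nonneg _)))
  simpa only [mul_smul_comm, mul_one] using this

lemma CB.neg (hf : CB q f) : CB q (fun ε τ => - f ε τ) := by
  simpa using hf.smul (c := fun _ => -1) (K := 1) zero_le_one (by simp)

lemma CB.sub (hf : CB q f) (hg : CB q g) : CB q (fun ε τ => f ε τ - g ε τ) := by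
  simpa only [sub_eq_add_neg] using hf.add hg.neg

lemma CB.int (hf : CB q f)
    (h : ∀ ε, ∀ τ : ℝ, 0 ≤ τ → HasDerivWithinAt (g ε) (f ε τ) (Set.Ici 0) τ)
    {C : ℝ} (hg : ∀ ε, ∀ τ : ℝ, 0 ≤ τ → ‖g ε τ‖ ≤ C) : CB (q + 1) g := by
  obtain ⟨c, K, hK, hb⟩ := hf
  have e : ∀ ε, Set.EqOn (derivWithin (g ε) (Set.Ici 0)) (f ε) (Set.Ici 0) := fun ε τ hτ =>
    (h ε τ hτ).derivWithin (uniqueDiffOn_Ici (0:ℝ) τ hτ)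
  refine ⟨fun ε => ?_, max K C, hK.trans (le_max_left _ _), fun p hp ε τ hτ => ?_⟩
  · push_cast
    rw [contDiffOn_succ_iff_derivWithin (uniqueDiffOn_Ici 0)]
    refine ⟨fun τ hτ => (h ε τ hτ).differentiableWithinAt, fun h => ?_, (c ε).congr (e ε)⟩
    exact absurd h (by simp)
  · cases p with
    | zero =>
      rw [iteratedDerivWithin_zero]
      exact (hg ε τ hτ).trans (le_max_right _ _)
    | succ p =>
      rw [iteratedDerivWithin_succ', iteratedDerivWithin_congr (e ε) hτ]
      exact (hb p (by omega) ε τ hτ).trans (le_max_left _ _)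

/-- The parameter set. -/
abbrev Par : Type := Set.Ioc (0:ℝ) 1

lemma par_pow (k : ℕ) (ε : Par) : |(ε : ℝ) ^ k| ≤ 1 := by
  rw [abs_of_nonneg (pow_nonneg ε.2.1.le _)]
  exact pow_le_one₀ ε.2.1.le ε.2.2

theorem formal (hω : Dio ω) (a : ℝ → E)
    (ha : SF ω Set.univ (fun _ : Par => a)) (hac : CB q (fun _ : Par => a)) (n : ℕ) :
    ∃ (Ψ R : Par → ℝ → E) (A : Par → E) (K : ℝ), 0 ≤ K ∧ (∀ ε, ‖A ε‖ ≤ K) ∧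
      SF ω {0}ᶜ Ψ ∧ CB (q + 1) Ψ ∧ SF ω {0}ᶜ R ∧ CB q R ∧
      SF ω {0}ᶜ (fun (ε : Par) τ => a τ * (1 + (ε : ℝ) • Ψ ε τ) - A ε) ∧
      ∀ ε : Par, ∀ τ : ℝ, 0 ≤ τ → HasDerivWithinAt (fun τ => 1 + (ε : ℝ) • Ψ ε τ)
        ((ε : ℝ) • (a τ * (1 + (ε : ℝ) • Ψ ε τ) - (1 + (ε : ℝ) • Ψ ε τ) * A ε
          + (ε : ℝ) ^ n • R ε τ)) (Set.Ici 0) τ := by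
  induction n with
  | zero =>
    obtain ⟨m, K, hK, hm, h⟩ := ha.split
    refine ⟨fun _ _ => 0, fun ε τ => -(a τ - m ε), m, K, hK, hm, SF.zero,
      CB.const (B := fun _ => (0 : E)) le_rfl (by simp), h.neg,
      (hac.sub (CB.const hK hm)).neg, ?_, fun ε τ hτ => ?_⟩
    · simpa using h
    · have := hasDerivWithinAt_const τ (Set.Ici (0:ℝ)) (1 : E)
      simpa using this
  | succ n ih =>
    obtain ⟨Ψ, R, A, K, hK, hA, hΨ, hΨc, hR, hRc, hm, hd⟩ := ih
    obtain ⟨G, hG, hGR⟩ := hR.int hω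
    obtain ⟨C, hC, hGb⟩ := hG.bdd
    have hGc : CB (q + 1) G := hRc.int hGR hGb
    obtain ⟨B, L, hL, hB, hBm⟩ := (ha.mul hG.univ).split
    have p0 := par_pow n
    have p1 := par_pow (n + 1)
    have hΨ' : SF ω {0}ᶜ (fun ε τ => Ψ ε τ - (ε : ℝ) ^ n • G ε τ) :=
      hΨ.sub (hG.smul zero_le_one p0)
    have hΨc' : CB (q + 1) (fun (ε : Par) τ => Ψ ε τ - (ε : ℝ) ^ n • G ε τ) :=
      hΨc.sub (hGc.smul zero_le_one p0)
    have q1 : ∀ ε : Par, |(ε : ℝ)| ≤ 1 := fun ε => by simpa using par_pow 1 ε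
    refine ⟨fun ε τ => Ψ ε τ - (ε : ℝ) ^ n • G ε τ,
      fun ε τ => a τ * G ε τ - B ε - G ε τ * A ε
        - (ε : ℝ) • (Ψ ε τ - (ε : ℝ) ^ n • G ε τ) * B ε,
      fun ε => A ε - (ε : ℝ) ^ (n + 1) • B ε, K + L, by positivity, fun ε => ?_, hΨ', hΨc', ?_, ?_,
      ?_, fun ε τ hτ => ?_⟩
    · refine (norm_sub_le _ _).trans (add_le_add (hA ε) ?_)
      rw [norm_smul, Real.norm_eq_abs]
      exact (mul_le_of_le_one_left (norm_nonneg _) (p1 ε)).trans (hB ε)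
    · exact (hBm.sub (hG.mul_const hK hA)).sub ((hΨ'.smul zero_le_one q1).mul_const hL hB)
    · have hG' := hGc.of_le (Nat.le_succ q)
      have hP' := hΨc'.of_le (Nat.le_succ q)
      exact (((hac.mul hG').sub (CB.const hL hB)).sub (hG'.mul (CB.const hK hA))).sub
        ((hP'.smul zero_le_one q1).mul (CB.const hL hB))
    · have h := hm.sub (hBm.smul zero_le_one p1)
      have e : (fun (ε : Par) τ => a τ * (1 + (ε : ℝ) • (Ψ ε τ - (ε : ℝ) ^ n • G ε τ))
          - (A ε - (ε : ℝ) ^ (n + 1) • B ε)) = fun (ε : Par) τ =>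
          (a τ * (1 + (ε : ℝ) • Ψ ε τ) - A ε) - (ε : ℝ) ^ (n + 1) • (a τ * G ε τ - B ε) := by
        funext ε τ
        simp only [mul_add, mul_sub, smul_sub, mul_smul_comm, smul_smul, pow_succ', mul_one]
        abel
      rw [e]
      exact h
    · have h := (hd ε τ hτ).sub ((hGR ε τ hτ).const_smul ((ε : ℝ) ^ (n + 1)))
      have e1 : (fun τ => 1 + (ε : ℝ) • (Ψ ε τ - (ε : ℝ) ^ n • G ε τ)) =
          (fun τ => 1 + (ε : ℝ) • Ψ ε τ) - (ε : ℝ) ^ (n + 1) • G ε := by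
        funext τ
        simp only [smul_sub, smul_smul, pow_succ', Pi.sub_apply, Pi.smul_apply]
        abel
      rw [e1]
      refine h.congr_deriv ?_
      simp only [mul_add, add_mul, mul_sub, sub_mul, smul_sub, smul_add, mul_smul_comm,
        smul_mul_assoc, smul_smul, one_mul, mul_one]
      module

end Calculus

lemma sharpFlat_bounds {r : ℕ} {ω : Fin r → ℝ} {μ M : ℝ} (hμ : 0 < μ)
    {a : ℝ → (X →L[ℂ] X)} {ahat : (Fin r → ℤ) → (X →L[ℂ] X)} {aflat : ℝ → (X →L[ℂ] X)}
    (ha : IsSharpFlat ω μ a ahat aflat) (haM : SFNorm μ ahat aflat ≤ M) :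
    SF ω Set.univ (fun _ : Par => a) ∧ ∀ τ : ℝ, 0 ≤ τ → ‖a τ‖ ≤ M := by
  have hu : Summable fun α => ‖ahat α‖ :=
    summable_u (J := Fin r → ℤ) (α := fun α => α) hμ.le (fun _ => norm_nonneg _) ha.summable
  have hle : ∀ α, ‖ahat α‖ ≤ Real.exp (μ * absIdx α) * ‖ahat α‖ := fun α =>
    le_mul_of_one_le_left (norm_nonneg _)
      (Real.one_le_exp (mul_nonneg hμ.le (absIdx_nonneg _)))
  have hfl : ∀ τ : ℝ, 0 ≤ τ → Real.exp τ * ‖aflat τ‖ ≤ flatSup aflat := fun τ hτ =>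
    le_ciSup ha.flat_bdd (⟨τ, hτ⟩ : Set.Ici (0:ℝ))
  have hn : ∀ τ α, ‖chr ω α τ • ahat α‖ = ‖ahat α‖ := fun τ α => by
    rw [norm_smul, norm_chr, one_mul]
  refine ⟨⟨μ, hμ, fun _ => sharpSum ω ahat, ⟨Fin r → ℤ, fun α => α, fun _ => ahat,
    fun α => ‖ahat α‖, fun _ => trivial, fun _ => norm_nonneg _, ha.summable, fun _ _ => le_rfl,
    fun ε τ => ?_⟩, fun ε => ?_, flatSup aflat, ?_, fun ε τ hτ => ?_⟩, fun τ hτ => ?_⟩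
  · exact (Summable.of_norm_bounded hu fun α => (hn τ α).le).hasSum
  · refine ha.flat_cont.congr fun τ hτ => ?_
    beta_reduce
    rw [ha.decomp τ hτ, add_sub_cancel_left]
  · exact le_trans (by positivity) (hfl 0 le_rfl)
  · beta_reduce
    rw [ha.decomp τ hτ, add_sub_cancel_left, Real.exp_neg, ← div_eq_mul_inv,
      le_div_iff₀ (Real.exp_pos _), mul_comm]
    exact hfl τ hτ
  · rw [ha.decomp τ hτ]
    refine (norm_add_le _ _).trans (le_trans (add_le_add ?_ ?_) haM)
    · exact tsum_of_norm_bounded ha.summable.hasSum fun α => (hn τ α).le.trans (hle α)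
    · exact (le_mul_of_one_le_left (norm_nonneg _) (Real.one_le_exp hτ)).trans (hfl τ hτ)

/-- bounds on the derivatives of the defect, Theorem 2.9 of the
paper. Under the Diophantine condition, if `a` is sharp-flat of class `μ` with
`𝒩_μ(a) ≤ M` and of class `C^q` with `sup_{p≤q}‖∂^p a‖ ≤ C_a M`, then for every `n`
there are `ε_n > 0`, `C_δ > 0`, independent of `ε`, such that for all `0 < ε ≤ ε_n`
there exist a `C^{q+1}` map `Φ : [0,∞) → End(X)` and `A ∈ End(X)` with `⟨Φ⟩ = id`,
`A = ⟨aΦ⟩`, `‖Φ − id‖ ≤ cε/ε_n`, `|A| ≤ (1+c)M`, whose defect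
`δ = ε⁻¹∂_τΦ − (aΦ − ΦA)` satisfies `|ε∫₀^τ δ| ≤ (ε/ε_n)^{n+1}` and
`sup_{p≤q}‖∂^p δ‖ ≤ C_δ M (ε/ε_n)^n`. -/
theorem defect_deriv_bounds
    {r : ℕ} (ω : Fin r → ℝ) (c_D ν : ℝ) (hcD : 0 < c_D) (hν : 0 < ν)
    (hdio : ∀ α : Fin r → ℤ, α ≠ 0 → c_D / (absIdx α) ^ ν ≤ |dotIdx ω α|)
    (μ M c C_a : ℝ) (q : ℕ)
    (hμ : 0 < μ) (hM : 0 < M) (hc0 : 0 < c) (hc1 : c < 1) (hCa : 0 < C_a)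
    (a : ℝ → (X →L[ℂ] X))
    (ahat : (Fin r → ℤ) → (X →L[ℂ] X)) (aflat : ℝ → (X →L[ℂ] X))
    (ha : IsSharpFlat ω μ a ahat aflat) (haM : SFNorm μ ahat aflat ≤ M)
    (haq : ContDiffOn ℝ (q : ℕ∞) a (Set.Ici 0))
    (habd : ∀ p ≤ q, ∀ τ : ℝ, 0 ≤ τ →
      ‖iteratedDerivWithin p a (Set.Ici 0) τ‖ ≤ C_a * M) :
    ∀ n : ℕ, ∃ εn Cδ : ℝ, 0 < εn ∧ 0 < Cδ ∧
      ∀ ε : ℝ, 0 < ε → ε ≤ εn →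
        ∃ (Φ : ℝ → (X →L[ℂ] X)) (A : X →L[ℂ] X),
          ContDiffOn ℝ ((q + 1 : ℕ) : ℕ∞) Φ (Set.Ici 0) ∧
          HasTimeAvg Φ 1 ∧
          HasTimeAvg (fun τ => a τ ∘L Φ τ) A ∧
          (∀ τ : ℝ, 0 ≤ τ → ‖Φ τ - 1‖ ≤ c * ε / εn) ∧
          ‖A‖ ≤ (1 + c) * M ∧
          (∀ τ : ℝ, 0 ≤ τ →
            ‖ε • ∫ σ in (0:ℝ)..τ,
                (ε⁻¹ • derivWithin Φ (Set.Ici 0) σ - (a σ ∘L Φ σ - Φ σ ∘L A))‖ ≤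
              (ε / εn) ^ (n + 1)) ∧
          (∀ p ≤ q, ∀ τ : ℝ, 0 ≤ τ →
            ‖iteratedDerivWithin p
                (fun σ => ε⁻¹ • derivWithin Φ (Set.Ici 0) σ - (a σ ∘L Φ σ - Φ σ ∘L A))
                (Set.Ici 0) τ‖ ≤ Cδ * M * (ε / εn) ^ n) := by
  intro n
  have hω : Dio ω := ⟨c_D, ν, hcD, hν, hdio⟩
  obtain ⟨haSF, haN⟩ := sharpFlat_bounds hμ ha haM
  have hac : CB q (fun _ : Par => a) :=
    ⟨fun _ => haq, C_a * M, by positivity, fun p hp _ τ hτ => habd p hp τ hτ⟩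
  obtain ⟨Ψ, R, A, -, -, -, hΨ, hΨc, hR, ⟨hRq, KR, hKR, hRb⟩, hm, hd⟩ := formal hω a haSF hac n
  obtain ⟨G, hG, hGR⟩ := hR.int hω
  obtain ⟨K1, hK1, hΨb⟩ := hΨ.bdd
  obtain ⟨K2, hK2, hGb⟩ := hG.bdd
  let K : ℝ := K1 + K2 + 1
  have hK : 1 ≤ K := by simp only [K]; linarith
  have hKpos : 0 < K := by linarith
  have h2K : 0 < 2 * K := by linarith
  let εn : ℝ := c / (2 * K)
  have hεn : 0 < εn := by positivity
  have hεn1 : εn ≤ 1 := by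
    rw [div_le_one h2K]; linarith
  have hεK : K * εn ≤ c := by
    have : K * εn = c / 2 := by simp only [εn]; field_simp
    linarith
  have hε2K : 2 * K * εn ≤ 1 := by
    have : 2 * K * εn = c := by simp only [εn]; field_simp
    linarith
  refine ⟨εn, (KR + 1) / M, hεn, by positivity, fun ε hε hεle => ?_⟩
  let e : Par := ⟨ε, hε, hεle.trans hεn1⟩
  let Φ : ℝ → (X →L[ℂ] X) := fun τ => 1 + ε • Ψ e τ
  have hder : ∀ τ : ℝ, 0 ≤ τ → HasDerivWithinAt Φ
      (ε • (a τ * Φ τ - Φ τ * A e + ε ^ n • R e τ)) (Set.Ici 0) τ := fun τ hτ => hd e τ hτ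
  have hΦc : ContDiffOn ℝ ((q + 1 : ℕ) : WithTop ℕ∞) Φ (Set.Ici 0) :=
    contDiffOn_const.add ((hΨc.1 e).const_smul ε)
  have hac0 : ContinuousOn a (Set.Ici 0) := haq.continuousOn
  have hdef : Set.EqOn (fun σ => ε⁻¹ • derivWithin Φ (Set.Ici 0) σ - (a σ ∘L Φ σ - Φ σ ∘L A e))
      (fun σ => ε ^ n • R e σ) (Set.Ici 0) := fun σ hσ => by
    beta_reduce
    rw [(hder σ hσ).derivWithin (uniqueDiffOn_Ici (0:ℝ) σ hσ), smul_smul, inv_mul_cancel₀ hε.ne',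
      one_smul]
    exact add_sub_cancel_left _ _
  have hΦ1 : ∀ τ : ℝ, 0 ≤ τ → ‖Φ τ - 1‖ ≤ c * ε / εn := fun τ hτ => by
    have h1 : Φ τ - 1 = ε • Ψ e τ := add_sub_cancel_left _ _
    have h2 := hΨb e τ hτ
    rw [h1, norm_smul, Real.norm_of_nonneg hε.le, le_div_iff₀ hεn]
    calc ε * ‖Ψ e τ‖ * εn ≤ ε * K * εn := by
          have : ‖Ψ e τ‖ ≤ K := by simp only [K]; linarith
          gcongr
      _ = ε * (K * εn) := by ring
      _ ≤ ε * c := by gcongr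
      _ = c * ε := by ring
  have hA : HasTimeAvg (fun τ => a τ ∘L Φ τ) (A e) :=
    avg_of_sub (hac0.mul hΦc.continuousOn) (hm.avg hω e)
  refine ⟨Φ, A e, hΦc, ?_, hA, hΦ1, ?_, ?_, ?_⟩
  · refine avg_of_sub hΦc.continuousOn ?_
    have h := (hΨ.smul (c := fun ε : Par => (ε : ℝ)) (K := 1) zero_le_one
      (fun ε => by simpa using par_pow 1 ε)).avg hω e
    have h1 : (fun τ => Φ τ - 1) = fun τ => ε • Ψ e τ := funext fun τ => add_sub_cancel_left _ _
    rw [h1]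
    exact h
  · refine avg_norm_le hA fun τ hτ => ?_
    have h1 : ‖Φ τ‖ ≤ 1 + c := by
      have h2 : c * ε / εn ≤ c := by
        rw [div_le_iff₀ hεn]; gcongr
      have h3 : ‖(1 : X →L[ℂ] X)‖ ≤ 1 := ContinuousLinearMap.norm_id_le
      calc ‖Φ τ‖ = ‖1 + (Φ τ - 1)‖ := by rw [add_sub_cancel]
        _ ≤ _ := norm_add_le _ _
        _ ≤ _ := add_le_add h3 ((hΦ1 τ hτ).trans h2)
    calc ‖a τ ∘L Φ τ‖ ≤ ‖a τ‖ * ‖Φ τ‖ := ContinuousLinearMap.opNorm_comp_le _ _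
      _ ≤ M * (1 + c) := mul_le_mul (haN τ hτ) h1 (norm_nonneg _) hM.le
      _ = _ := mul_comm _ _
  · intro τ hτ
    have hsub : Set.uIcc 0 τ ⊆ Set.Ici 0 := by
      rw [Set.uIcc_of_le hτ]; exact Set.Icc_subset_Ici_self
    rw [intervalIntegral.integral_congr (hdef.mono hsub), intervalIntegral.integral_smul,
      ftc (hR.cont e) (hGR e) hτ, smul_smul, norm_smul, Real.norm_of_nonneg (by positivity),
      ← pow_succ', div_pow, div_eq_mul_inv]
    gcongr
    have h1 : ‖G e τ - G e 0‖ ≤ 2 * K := by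
      refine (norm_sub_le _ _).trans ?_
      have := hGb e τ hτ
      have := hGb e 0 le_rfl
      simp only [K]; linarith
    refine h1.trans ?_
    have h2 : εn ^ (n + 1) ≤ εn := by
      simpa using pow_le_pow_of_le_one hεn.le hεn1 (Nat.succ_le_succ (Nat.zero_le n))
    rw [le_inv_comm₀ h2K (by positivity)]
    refine h2.trans ?_
    rw [← one_div, le_div_iff₀ h2K]
    linarith
  · intro p hp τ hτ
    rw [iteratedDerivWithin_congr hdef hτ]
    have hpq : (p : WithTop ℕ∞) ≤ q := by exact_mod_cast hp
    have h1 : iteratedDerivWithin p (fun σ => ε ^ n • R e σ) (Set.Ici 0) τ =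
        ε ^ n • iteratedDerivWithin p (R e) (Set.Ici 0) τ :=
      iteratedDerivWithin_const_smul (Set.mem_Ici.2 hτ) (uniqueDiffOn_Ici 0) (ε ^ n)
        (((hRq e).of_le hpq) τ hτ)
    rw [h1, norm_smul, Real.norm_of_nonneg (by positivity), div_mul_cancel₀ _ hM.ne', mul_comm]
    have h2 : ε ≤ ε / εn := by
      rw [le_div_iff₀ hεn]; exact mul_le_of_le_one_right hε.le hεn1
    have h3 := hRb p hp e τ hτ
    gcongr
    linarith
end
end
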